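/- arXiv:1404.3320 — 7 statements merged into one kernel-verified Lean document; each statement's English description precedes it below -/
import Mathlib

section
/- For every d ≥ 1 and every k with 0 ≤ k < 2^d − 1, if i is the unique coordinate in which G_d[k] and G_d[k+1] differ, then the prefix sum ∑_{j=1}^{i} (G_d[k])_j is even, where bits are counted as integers 0 or 1 and the sum includes the i-th bit itself. -/
/-- The `d`-bit Gray code: `grayCode d k` is the `k`-th bit string (length `d`)
of the Gray code sequence, `G₁ = (0,1)`,
`G_{d+1}[k] = 0·G_d[k]` if `k < 2^d` and `G_{d+1}[k] = 1·G_d[2^{d+1}-1-k]` otherwise. -/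
def grayCode : (d : ℕ) → ℕ → (Fin d → Bool)
  | 0, _ => fun i => i.elim0
  | d + 1, k =>
    if k < 2 ^ d then Fin.cons false (grayCode d k)
    else Fin.cons true (grayCode d (2 ^ (d + 1) - 1 - k))

/-- The number of `true` entries of `f` among the coordinates up to and including `i`. -/
def prefixSum {d : ℕ} (f : Fin d → Bool) (i : Fin d) : ℕ :=
  ∑ j ∈ Finset.univ.filter (fun j : Fin d => j ≤ i), (if f j = true then 1 else 0 : ℕ)

theorem prefixSum_cons_zero {d : ℕ} (b : Bool) (f : Fin d → Bool) :
    prefixSum (Fin.cons b f : Fin (d + 1) → Bool) 0 = if b = true then 1 else 0 := by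
  simp [prefixSum, Finset.sum_filter, -Finset.sum_boole]

theorem prefixSum_cons_succ {d : ℕ} (b : Bool) (f : Fin d → Bool) (i : Fin d) :
    prefixSum (Fin.cons b f : Fin (d + 1) → Bool) i.succ =
      (if b = true then 1 else 0) + prefixSum f i := by
  simp [prefixSum, Finset.sum_filter, Fin.sum_univ_succ, -Finset.sum_boole]

theorem grayCode_succ_of_lt {d k : ℕ} (h : k < 2 ^ d) :
    grayCode (d + 1) k = Fin.cons false (grayCode d k) := by
  rw [grayCode, if_pos h]

theorem grayCode_succ_of_le {d k : ℕ} (h : 2 ^ d ≤ k) :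
    grayCode (d + 1) k = Fin.cons true (grayCode d (2 ^ (d + 1) - 1 - k)) := by
  rw [grayCode, if_neg h.not_gt]

/-- At a coordinate where consecutive Gray code words differ, the prefix sum is even for the
first word and odd for the second. -/
theorem prefixSum_grayCode_parity {d k : ℕ} (hk : k + 1 < 2 ^ d) {i : Fin d}
    (hi : grayCode d k i ≠ grayCode d (k + 1) i) :
    Even (prefixSum (grayCode d k) i) ∧ Odd (prefixSum (grayCode d (k + 1)) i) := by
  induction d generalizing k with
  | zero => exact i.elim0
  | succ d ih =>
    have hpow : 2 ^ (d + 1) = 2 * 2 ^ d := pow_succ' 2 d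
    rcases lt_trichotomy (k + 1) (2 ^ d) with h | h | h
    · rw [grayCode_succ_of_lt (k.lt_succ_self.trans h), grayCode_succ_of_lt h] at hi ⊢
      cases i using Fin.cases with
      | zero => simp at hi
      | succ i => simpa [prefixSum_cons_succ] using ih h (by simpa using hi)
    · rw [grayCode_succ_of_lt (show k < 2 ^ d by omega), grayCode_succ_of_le h.ge,
        show 2 ^ (d + 1) - 1 - (k + 1) = k by omega] at hi ⊢
      cases i using Fin.cases with
      | zero => simp [prefixSum_cons_zero]
      | succ i => simp at hi
    · obtain ⟨m, hm⟩ : ∃ m, 2 ^ (d + 1) - 1 - (k + 1) = m := ⟨_, rfl⟩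
      rw [grayCode_succ_of_le (show 2 ^ d ≤ k by omega), grayCode_succ_of_le h.le, hm,
        show 2 ^ (d + 1) - 1 - k = m + 1 by omega] at hi ⊢
      cases i using Fin.cases with
      | zero => simp at hi
      | succ i =>
        obtain ⟨he, ho⟩ := ih (k := m) (by omega) (by simpa using hi.symm)
        simp only [prefixSum_cons_succ, if_true]
        exact ⟨odd_one.add_odd ho, odd_one.add_even he⟩

/-- If `i` is a coordinate in which `G_d[k]` and `G_d[k+1]` differ, then the prefix
sum of the bits of `G_d[k]` up to and including the `i`-th bit is even. -/
theorem grayCode_flip_prefixSum_even (d k : ℕ) (hd : 1 ≤ d) (hk : k < 2 ^ d - 1)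
    (i : Fin d) (hi : grayCode d k i ≠ grayCode d (k + 1) i) :
    Even (∑ j ∈ Finset.univ.filter (fun j : Fin d => j ≤ i),
      (if grayCode d k j = true then 1 else 0 : ℕ)) := by
  exact (prefixSum_grayCode_parity (by omega) hi).1
end

section
/- Fix d ≥ 1 and a real ε with 0 < ε < 1/2. For every bit string b ∈ {0,1}^d and every coordinate i with 1 ≤ i ≤ d, flipping the i-th bit of b strictly increases the first coordinate of the associated Klee-Minty vertex, i.e. v(flip_i(b))_1 > v(b)_1, if and only if the prefix sum ∑_{j=1}^{i} b_j is even (bits counted as integers 0 or 1, the sum including b_i). -/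
/-- Helper for the Klee-Minty vertex: value of the top coordinate for a list of bits,
via the downward recursion `v_i = ε·v_{i+1}` if `b_i = 0`, `v_i = 1 - ε·v_{i+1}` if `b_i = 1`,
with `v` of the empty list equal to `0` (so a single bit gives `0` or `1`). -/
noncomputable def kmF (ε : ℝ) : List Bool → ℝ
  | [] => 0
  | x :: l => if x = true then 1 - ε * kmF ε l else ε * kmF ε l

/-- The Klee-Minty vertex `v(b) ∈ ℝ^d` of a bit string `b ∈ {0,1}^d`:
`v(b)_{d-1} = b_{d-1}` and `v(b)_i = ε·v(b)_{i+1}` if `b_i = 0`,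
`v(b)_i = 1 - ε·v(b)_{i+1}` if `b_i = 1` (0-indexed). -/
noncomputable def kmVertex (ε : ℝ) (d : ℕ) (b : Fin d → Bool) : Fin d → ℝ :=
  fun i => kmF ε ((List.ofFn b).drop i.val)

/-- Flip the `i`-th bit of the bit string `b`. -/
def flipBit (d : ℕ) (b : Fin d → Bool) (i : Fin d) : Fin d → Bool :=
  fun j => if j = i then !(b j) else b j

theorem kmF_mem_Icc {ε : ℝ} (hε0 : 0 ≤ ε) (hε1 : ε ≤ 1) (l : List Bool) :
    kmF ε l ∈ Set.Icc (0 : ℝ) 1 := by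
  induction l with
  | nil => simp [kmF]
  | cons x l ih =>
    obtain ⟨h0, h1⟩ := ih
    have hm : 0 ≤ ε * kmF ε l := mul_nonneg hε0 h0
    have hm1 : ε * kmF ε l ≤ 1 := mul_le_one₀ hε1 h0 h1
    cases x <;> simp [kmF] <;> constructor <;> linarith

theorem flipBit_zero_zero (d : ℕ) (b : Fin (d + 1) → Bool) :
    flipBit (d + 1) b 0 0 = !(b 0) := by
  simp [flipBit]

theorem flipBit_zero_succ (d : ℕ) (b : Fin (d + 1) → Bool) (j : Fin d) :
    flipBit (d + 1) b 0 j.succ = b j.succ := by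
  simp [flipBit]

theorem flipBit_succ_zero (d : ℕ) (b : Fin (d + 1) → Bool) (i : Fin d) :
    flipBit (d + 1) b i.succ 0 = b 0 := by
  simp [flipBit, (Fin.succ_ne_zero i).symm]

theorem flipBit_succ_succ (d : ℕ) (b : Fin (d + 1) → Bool) (i j : Fin d) :
    flipBit (d + 1) b i.succ j.succ = flipBit d (fun k => b k.succ) i j := by
  simp [flipBit]

/-- Flipping a bit moves `kmF` strictly up or strictly down, according to the parity of the
prefix sum. -/
theorem kmF_flipBit_lt_or_gt {ε : ℝ} (hε0 : 0 < ε) (hε1 : ε < 1 / 2) (d : ℕ)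
    (b : Fin d → Bool) (i : Fin d) :
    if Even (∑ j : Fin d, if j ≤ i then (if b j = true then 1 else 0 : ℕ) else 0)
    then kmF ε (List.ofFn b) < kmF ε (List.ofFn (flipBit d b i))
    else kmF ε (List.ofFn (flipBit d b i)) < kmF ε (List.ofFn b) := by
  induction d with
  | zero => exact i.elim0
  | succ d ih =>
    rw [Fin.sum_univ_succ, List.ofFn_succ, List.ofFn_succ]
    cases i using Fin.cases with
    | zero =>
      simp only [flipBit_zero_zero, flipBit_zero_succ]
      obtain ⟨h0, h1⟩ := kmF_mem_Icc hε0.le (by linarith) (List.ofFn fun j => b j.succ)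
      have hm : ε * kmF ε (List.ofFn fun j => b j.succ) < 1 / 2 := by nlinarith
      cases b 0 <;> simp [kmF] <;> linarith
    | succ i =>
      have h := ih (fun k => b k.succ) i
      simp only [flipBit_succ_zero, flipBit_succ_succ, Fin.succ_le_succ_iff]
      change if _ then _ < kmF ε (_ :: List.ofFn (flipBit d (fun k => b k.succ) i))
        else kmF ε (_ :: List.ofFn (flipBit d (fun k => b k.succ) i)) < _
      split_ifs at h with hp <;> cases b 0 <;>
        simp [kmF, hp, hε0, h, Nat.even_add, -Nat.not_even_iff_odd]

/-- Flipping the `i`-th bit of `b` strictly increases the first coordinate of the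
Klee-Minty vertex iff the prefix sum of the bits of `b` up to and including the
`i`-th bit is even. -/
theorem kmVertex_flip_increasing_iff (d : ℕ) (hd : 1 ≤ d) (ε : ℝ)
    (hε0 : 0 < ε) (hε1 : ε < 1 / 2) (b : Fin d → Bool) (i : Fin d) :
    kmVertex ε d (flipBit d b i) ⟨0, hd⟩ > kmVertex ε d b ⟨0, hd⟩ ↔
      Even (∑ j ∈ Finset.univ.filter (fun j : Fin d => j ≤ i),
        (if b j = true then 1 else 0 : ℕ)) := by
  have h := kmF_flipBit_lt_or_gt hε0 hε1 d b i
  rw [Finset.sum_filter]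
  simp only [kmVertex, List.drop_zero, gt_iff_lt]
  split_ifs at h with hp
  · exact iff_of_true h hp
  · exact iff_of_false h.not_gt hp
end

section
/- Fix d ≥ 1 and a real ε with 0 < ε < 1/2. The map b ↦ v(b)_1 from bit strings to the first coordinate of the associated Klee-Minty vertex is injective: if b, b' ∈ {0,1}^d and b ≠ b', then v(b)_1 ≠ v(b')_1 (the Klee-Minty linear program is non-degenerate in its objective values). -/
theorem kmF_injective_of_length_eq {ε : ℝ} (hε0 : 0 < ε) (hε1 : ε < 1 / 2) :
    ∀ {l l' : List Bool}, l.length = l'.length → kmF ε l = kmF ε l' → l = l'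
  | [], [], _, _ => rfl
  | x :: l, y :: l', hlen, h => by
    have key (m : List Bool) : ε * kmF ε m < 1 / 2 :=
      (mul_le_of_le_one_right hε0.le
        (kmF_mem_Icc hε0.le (by linarith) m).2).trans_lt hε1
    have hl := key l
    have hl' := key l'
    have tail (ht : ε * kmF ε l = ε * kmF ε l') : l = l' :=
      kmF_injective_of_length_eq hε0 hε1 (by simpa using hlen)
        (mul_left_cancel₀ hε0.ne' ht)
    cases x <;> cases y <;> simp only [kmF, if_true, Bool.false_eq_true, if_false] at h
    · rw [tail h]
    · linarith
    · linarith
    · rw [tail (by linarith)]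

/-- The first coordinate of the Klee-Minty vertex map is injective on bit strings:
distinct `b, b' ∈ {0,1}^d` have distinct objective values. -/
theorem kmVertex_first_injective (d : ℕ) (hd : 1 ≤ d) (ε : ℝ)
    (hε0 : 0 < ε) (hε1 : ε < 1 / 2) (b b' : Fin d → Bool) (hne : b ≠ b') :
    kmVertex ε d b ⟨0, hd⟩ ≠ kmVertex ε d b' ⟨0, hd⟩ := by
  intro h
  refine hne (List.ofFn_injective
    (kmF_injective_of_length_eq hε0 hε1 (by simp) ?_))
  simpa only [kmVertex, List.drop_zero] using h
end

section
/- Fix d ≥ 1 and a real ε with 0 < ε < 1/2. For every bit string b ∈ {0,1}^d, the point v(b) is an extreme point of the Klee-Minty polytope P_ε. -/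
/-- The Klee-Minty polytope `P_ε ⊆ ℝ^d`: the points `x` with `x_i ≥ 0` for all `i`,
`x_{d-1} ≤ 1` (last coordinate, 0-indexed), and
`ε·x_{i+1} ≤ x_i ≤ 1 - ε·x_{i+1}` for all `i` with `i + 1 < d`. -/
def kmPolytope (ε : ℝ) (d : ℕ) : Set (Fin d → ℝ) :=
  {x | (∀ i : Fin d, 0 ≤ x i) ∧ (∀ i : Fin d, i.val = d - 1 → x i ≤ 1) ∧
    ∀ (i : Fin d) (h : i.val + 1 < d),
      ε * x ⟨i.val + 1, h⟩ ≤ x i ∧ x i ≤ 1 - ε * x ⟨i.val + 1, h⟩}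

theorem kmF_drop_ofFn (ε : ℝ) {d : ℕ} (b : Fin d → Bool) {n : ℕ} (hn : n < d) :
    kmF ε ((List.ofFn b).drop n) =
      if b ⟨n, hn⟩ = true then 1 - ε * kmF ε ((List.ofFn b).drop (n + 1))
      else ε * kmF ε ((List.ofFn b).drop (n + 1)) := by
  rw [List.drop_eq_getElem_cons (by simpa using hn)]
  simp [kmF]

theorem kmVertex_mem_kmPolytope {ε : ℝ} (hε0 : 0 ≤ ε) (hε1 : ε ≤ 1 / 2) {d : ℕ}
    (b : Fin d → Bool) : kmVertex ε d b ∈ kmPolytope ε d := by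
  have hI := kmF_mem_Icc hε0 (by linarith : ε ≤ 1)
  refine ⟨fun i => (hI _).1, fun i _ => (hI _).2, fun i h => ?_⟩
  obtain ⟨h0, h1⟩ := hI ((List.ofFn b).drop (i.val + 1))
  have h2 : ε * kmF ε ((List.ofFn b).drop (i.val + 1)) ≤ 1 / 2 := by nlinarith
  simp only [kmVertex]
  rw [kmF_drop_ofFn ε b i.isLt]
  split_ifs <;> constructor <;> linarith

/-- The coordinates of `x`, extended by zero beyond the last one. -/
def extendZero {d : ℕ} (x : Fin d → ℝ) (n : ℕ) : ℝ :=
  if h : n < d then x ⟨n, h⟩ else 0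

theorem extendZero_bounds {ε : ℝ} {d : ℕ} {x : Fin d → ℝ} (hx : x ∈ kmPolytope ε d)
    {n : ℕ} (hn : n < d) :
    ε * extendZero x (n + 1) ≤ extendZero x n ∧
      extendZero x n ≤ 1 - ε * extendZero x (n + 1) := by
  obtain ⟨h0, h1, h2⟩ := hx
  by_cases h : n + 1 < d
  · simpa [extendZero, hn, h] using h2 ⟨n, hn⟩ h
  · simpa [extendZero, hn, h] using And.intro (h0 ⟨n, hn⟩) (h1 ⟨n, hn⟩ (by simp; omega))

theorem eq_and_eq_of_convex_combination_eq {a c s t v : ℝ} (ha : 0 < a) (hc : 0 < c)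
    (hac : a + c = 1) (h : a * s + c * t = v) (hb : v ≤ s ∧ v ≤ t ∨ s ≤ v ∧ t ≤ v) :
    s = v ∧ t = v := by
  obtain rfl : c = 1 - a := by linarith
  rcases hb with ⟨h1, h2⟩ | ⟨h1, h2⟩ <;> constructor <;> nlinarith

/-- Every point `v(b)` is an extreme point of the Klee-Minty polytope. -/
theorem kmVertex_extremePoint (d : ℕ) (hd : 1 ≤ d) (ε : ℝ)
    (hε0 : 0 < ε) (hε1 : ε < 1 / 2) (b : Fin d → Bool) :
    kmVertex ε d b ∈ Set.extremePoints ℝ (kmPolytope ε d) := by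
  refine ⟨kmVertex_mem_kmPolytope hε0.le hε1.le b, ?_⟩
  rintro x hx y hy ⟨a, c, ha, hc, hac, hxy⟩
  have key : ∀ k n : ℕ, n + k = d →
      extendZero x n = kmF ε ((List.ofFn b).drop n) ∧
        extendZero y n = kmF ε ((List.ofFn b).drop n) := by
    intro k
    induction k with
    | zero =>
      intro n hn
      rw [List.drop_eq_nil_of_le (by simp; omega)]
      simp [extendZero, kmF, show ¬ n < d by omega]
    | succ k ih =>
      intro n hnk
      have hn : n < d := by omega
      obtain ⟨hx1, hy1⟩ := ih (n + 1) (by omega)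
      have hxb := extendZero_bounds hx hn
      have hyb := extendZero_bounds hy hn
      rw [hx1] at hxb
      rw [hy1] at hyb
      have hv : a * extendZero x n + c * extendZero y n = kmF ε ((List.ofFn b).drop n) := by
        simpa [extendZero, hn, kmVertex] using congrFun hxy ⟨n, hn⟩
      refine eq_and_eq_of_convex_combination_eq ha hc hac hv ?_
      rw [kmF_drop_ofFn ε b hn]
      split_ifs
      · exact Or.inr ⟨hxb.2, hyb.2⟩
      · exact Or.inl ⟨hxb.1, hyb.1⟩
  funext i
  simpa [extendZero, kmVertex] using (key (d - i) i (by omega)).1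
end

section
/- Fix d ≥ 1 and a real ε with 0 < ε < 1/2. The set of extreme points of the Klee-Minty polytope P_ε is exactly {v(b) : b ∈ {0,1}^d}; that is, the vertices of P_ε are in one-to-one correspondence with the bit strings of length d. -/
/-- The first coordinate of a vector, or `0` in dimension zero. -/
def headOrZero : (d : ℕ) → (Fin d → ℝ) → ℝ
  | 0, _ => 0
  | _ + 1, x => x 0

lemma headOrZero_smul_add_smul (d : ℕ) (a b : ℝ) (x y : Fin d → ℝ) :
    headOrZero d (a • x + b • y) = a * headOrZero d x + b * headOrZero d y := by
  cases d <;> simp [headOrZero]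

lemma mem_kmPolytope_succ {ε : ℝ} (hε0 : 0 < ε) (d : ℕ) (x : Fin (d + 1) → ℝ) :
    x ∈ kmPolytope ε (d + 1) ↔ Fin.tail x ∈ kmPolytope ε d ∧
      ε * headOrZero d (Fin.tail x) ≤ x 0 ∧ x 0 ≤ 1 - ε * headOrZero d (Fin.tail x) := by
  cases d with
  | zero =>
    simp only [headOrZero, mul_zero, sub_zero]
    constructor
    · rintro ⟨h0, h1, -⟩
      exact ⟨⟨fun i => i.elim0, fun i => i.elim0, fun i => i.elim0⟩, h0 0, h1 0 rfl⟩
    · rintro ⟨-, h0, h1⟩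
      refine ⟨fun i => ?_, fun i _ => ?_, fun i hi => absurd hi (by omega)⟩ <;>
        rwa [Fin.fin_one_eq_zero i]
  | succ d =>
    constructor
    · rintro ⟨h0, h1, h2⟩
      refine ⟨⟨fun i => h0 i.succ, fun i hi => h1 i.succ (by simp at hi ⊢; omega),
        fun i hi => h2 i.succ (by simpa using hi)⟩, ?_⟩
      exact h2 0 (by simp)
    · rintro ⟨⟨h0, h1, h2⟩, h3⟩
      refine ⟨fun i => ?_, fun i hi => ?_, fun i hi => ?_⟩
      · refine Fin.cases ?_ h0 i
        exact (mul_nonneg hε0.le (h0 0)).trans h3.1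
      · induction i using Fin.cases with
        | zero => simp at hi
        | succ i => exact h1 i (by simp at hi ⊢; omega)
      · induction i using Fin.cases with
        | zero => exact h3
        | succ i => exact h2 i (by simpa using hi)

lemma headOrZero_mem_Icc {ε : ℝ} (hε0 : 0 < ε) {d : ℕ} {x : Fin d → ℝ}
    (hx : x ∈ kmPolytope ε d) : 0 ≤ headOrZero d x ∧ headOrZero d x ≤ 1 := by
  induction d with
  | zero => simp [headOrZero]
  | succ d ih =>
    obtain ⟨ht, h1, h2⟩ := (mem_kmPolytope_succ hε0 d x).1 hx
    have := mul_nonneg hε0.le (ih ht).1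
    exact ⟨this.trans h1, by change x 0 ≤ 1; linarith⟩

lemma kmVertex_tail (ε : ℝ) (d : ℕ) (b : Fin (d + 1) → Bool) :
    Fin.tail (kmVertex ε (d + 1) b) = kmVertex ε d (Fin.tail b) := by
  funext i
  simp [kmVertex, Fin.tail, List.ofFn_succ]
  rfl

lemma kmVertex_zero (ε : ℝ) (d : ℕ) (b : Fin (d + 1) → Bool) :
    kmVertex ε (d + 1) b 0 =
      if b 0 = true then 1 - ε * headOrZero d (kmVertex ε d (Fin.tail b))
      else ε * headOrZero d (kmVertex ε d (Fin.tail b)) := by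
  cases d <;> simp [kmVertex, kmF, headOrZero, Fin.tail, List.ofFn_succ]

lemma mem_range_kmVertex_succ (ε : ℝ) (d : ℕ) (x : Fin (d + 1) → ℝ) :
    x ∈ Set.range (kmVertex ε (d + 1)) ↔ Fin.tail x ∈ Set.range (kmVertex ε d) ∧
      (x 0 = ε * headOrZero d (Fin.tail x) ∨ x 0 = 1 - ε * headOrZero d (Fin.tail x)) := by
  constructor
  · rintro ⟨b, rfl⟩
    rw [kmVertex_tail, kmVertex_zero]
    refine ⟨⟨_, rfl⟩, ?_⟩
    split_ifs <;> simp
  · rintro ⟨⟨b, hb⟩, h⟩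
    have key (c : Bool) (hc : x 0 = if c = true then 1 - ε * headOrZero d (Fin.tail x)
        else ε * headOrZero d (Fin.tail x)) : x ∈ Set.range (kmVertex ε (d + 1)) := by
      refine ⟨Fin.cons c b, ?_⟩
      rw [← Fin.cons_self_tail (kmVertex ε (d + 1) (Fin.cons c b)), kmVertex_tail,
        kmVertex_zero, Fin.tail_cons, Fin.cons_zero, hb, ← hc, Fin.cons_self_tail]
    rcases h with h | h
    · exact key false (by simpa using h)
    · exact key true (by simpa using h)

lemma mem_extremePoints_kmPolytope_succ {ε : ℝ} (hε0 : 0 < ε) (hε1 : ε < 1 / 2) (d : ℕ)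
    (x : Fin (d + 1) → ℝ) :
    x ∈ Set.extremePoints ℝ (kmPolytope ε (d + 1)) ↔
      Fin.tail x ∈ Set.extremePoints ℝ (kmPolytope ε d) ∧
      (x 0 = ε * headOrZero d (Fin.tail x) ∨ x 0 = 1 - ε * headOrZero d (Fin.tail x)) := by
  have hle {y : Fin d → ℝ} (hy : y ∈ kmPolytope ε d) :
      ε * headOrZero d y ≤ 1 - ε * headOrZero d y := by
    obtain ⟨h0, h1⟩ := headOrZero_mem_Icc hε0 hy
    nlinarith
  constructor
  · rintro ⟨hx, hext⟩
    obtain ⟨ht, h1, h2⟩ := (mem_kmPolytope_succ hε0 d x).1 hx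
    have htight : x 0 = ε * headOrZero d (Fin.tail x) ∨
        x 0 = 1 - ε * headOrZero d (Fin.tail x) := by
      by_contra! hne
      have h1' := lt_of_le_of_ne h1 hne.1.symm
      have h2' := lt_of_le_of_ne h2 hne.2
      obtain ⟨δ, hδ, hδ'⟩ := exists_between (lt_min (sub_pos.2 h1') (sub_pos.2 h2'))
      obtain ⟨hδ1, hδ2⟩ := lt_min_iff.1 hδ'
      have hmem (t : ℝ) (ht1 : ε * headOrZero d (Fin.tail x) ≤ t)
          (ht2 : t ≤ 1 - ε * headOrZero d (Fin.tail x)) :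
          (Fin.cons t (Fin.tail x) : Fin (d + 1) → ℝ) ∈ kmPolytope ε (d + 1) := by
        rw [mem_kmPolytope_succ hε0]
        simpa using ⟨ht, ht1, ht2⟩
      have heq := hext (hmem (x 0 - δ) (by linarith) (by linarith))
        (hmem (x 0 + δ) (by linarith) (by linarith))
        ⟨1 / 2, 1 / 2, by norm_num, by norm_num, by norm_num, by
          funext i
          induction i using Fin.cases with
          | zero => simp; ring
          | succ i => simp [Fin.tail]; ring⟩
      have := congrFun heq 0
      simp at this
      linarith
    refine ⟨⟨ht, ?_⟩, htight⟩
    rintro p hp q hq ⟨a, b, ha, hb, hab, hpq⟩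
    have hlin := headOrZero_smul_add_smul d a b p q
    rw [hpq] at hlin
    have key (g : (Fin d → ℝ) → ℝ) (hg : a * g p + b * g q = x 0)
        (hgm : ∀ y ∈ kmPolytope ε d,
          ε * headOrZero d y ≤ g y ∧ g y ≤ 1 - ε * headOrZero d y) : p = Fin.tail x := by
      have hmem (y) (hy : y ∈ kmPolytope ε d) :
          (Fin.cons (g y) y : Fin (d + 1) → ℝ) ∈ kmPolytope ε (d + 1) := by
        rw [mem_kmPolytope_succ hε0]
        simpa using ⟨hy, hgm y hy⟩
      have heq := hext (hmem p hp) (hmem q hq) ⟨a, b, ha, hb, hab, by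
          funext i
          induction i using Fin.cases with
          | zero => simpa using hg
          | succ i => simpa [Fin.tail] using congrFun hpq i⟩
      rw [← heq, Fin.tail_cons]
    rcases htight with h | h
    · exact key (fun y => ε * headOrZero d y) (by rw [h, hlin]; ring)
        fun y hy => ⟨le_rfl, hle hy⟩
    · exact key (fun y => 1 - ε * headOrZero d y)
        (by rw [h, hlin]; linear_combination hab) fun y hy => ⟨hle hy, le_rfl⟩
  · rintro ⟨ht, htight⟩
    have hx : x ∈ kmPolytope ε (d + 1) := by
      refine (mem_kmPolytope_succ hε0 d x).2 ⟨ht.1, ?_⟩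
      have := hle ht.1
      rcases htight with h | h <;> constructor <;> linarith
    rw [mem_extremePoints] at ht ⊢
    refine ⟨hx, ?_⟩
    rintro p hp q hq ⟨a, b, ha, hb, hab, hpq⟩
    obtain ⟨hpt, hp1, hp2⟩ := (mem_kmPolytope_succ hε0 d p).1 hp
    obtain ⟨hqt, hq1, hq2⟩ := (mem_kmPolytope_succ hε0 d q).1 hq
    obtain ⟨hp', hq'⟩ := ht.2 _ hpt _ hqt
      ⟨a, b, ha, hb, hab, funext fun i => congrFun hpq i.succ⟩
    have h0 : a * p 0 + b * q 0 = x 0 := congrFun hpq 0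
    rw [hp'] at hp1 hp2
    rw [hq'] at hq1 hq2
    have hz : p 0 = x 0 ∧ q 0 = x 0 := by
      obtain rfl : b = 1 - a := by linarith
      rcases htight with h | h <;> constructor <;> nlinarith
    constructor
    · rw [← Fin.cons_self_tail p, hp', hz.1, Fin.cons_self_tail]
    · rw [← Fin.cons_self_tail q, hq', hz.2, Fin.cons_self_tail]

lemma extremePoints_kmPolytope {ε : ℝ} (hε0 : 0 < ε) (hε1 : ε < 1 / 2) (d : ℕ) :
    Set.extremePoints ℝ (kmPolytope ε d) = Set.range (kmVertex ε d) := by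
  induction d with
  | zero =>
    ext x
    refine ⟨fun _ => ⟨Fin.elim0, Subsingleton.elim _ _⟩, fun _ => ⟨?_, ?_⟩⟩
    · exact ⟨fun i => i.elim0, fun i => i.elim0, fun i => i.elim0⟩
    · exact fun _ _ _ _ _ => Subsingleton.elim _ _
  | succ d ih =>
    ext x
    rw [mem_extremePoints_kmPolytope_succ hε0 hε1, mem_range_kmVertex_succ, ih]

lemma kmVertex_injective {ε : ℝ} (hε0 : 0 < ε) (hε1 : ε < 1 / 2) (d : ℕ) :
    Function.Injective (kmVertex ε d) := by
  induction d with
  | zero => exact Function.injective_of_subsingleton _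
  | succ d ih =>
    intro b c hbc
    have ht : Fin.tail b = Fin.tail c := ih (by rw [← kmVertex_tail, hbc, kmVertex_tail])
    have h0 := congrFun hbc 0
    have hmem : kmVertex ε d (Fin.tail c) ∈ kmPolytope ε d :=
      ((extremePoints_kmPolytope hε0 hε1 d).symm ▸ Set.mem_range_self _ :
        _ ∈ Set.extremePoints ℝ (kmPolytope ε d)).1
    obtain ⟨hh0, hh1⟩ := headOrZero_mem_Icc hε0 hmem
    rw [kmVertex_zero, kmVertex_zero, ht] at h0
    have hbit : b 0 = c 0 := by
      cases hb : b 0 <;> cases hc : c 0 <;> simp [hb, hc] at h0 ⊢ <;> nlinarith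
    rw [← Fin.cons_self_tail b, ht, hbit, Fin.cons_self_tail]

/-- The extreme points of the Klee-Minty polytope are exactly the points `v(b)` for
bit strings `b ∈ {0,1}^d`, and these are in one-to-one correspondence with the
bit strings (the map `b ↦ v(b)` is injective). -/
theorem kmPolytope_extremePoints_eq (d : ℕ) (hd : 1 ≤ d) (ε : ℝ)
    (hε0 : 0 < ε) (hε1 : ε < 1 / 2) :
    Set.extremePoints ℝ (kmPolytope ε d) = Set.range (kmVertex ε d) ∧
      Function.Injective (kmVertex ε d) :=
  ⟨extremePoints_kmPolytope hε0 hε1 d, kmVertex_injective hε0 hε1 d⟩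
end

section
/- Fix d ≥ 1 and a real ε with 0 < ε < 1/2. The Klee-Minty polytope P_ε has exactly 2^d extreme points. -/
/-- The region over `P` lying between the graphs of `f` and `g`, with the height as
coordinate `0`. -/
def prismBetween {n : ℕ} (P : Set (Fin n → ℝ)) (f g : (Fin n → ℝ) → ℝ) :
    Set (Fin (n + 1) → ℝ) :=
  {x | Fin.tail x ∈ P ∧ f (Fin.tail x) ≤ x 0 ∧ x 0 ≤ g (Fin.tail x)}

theorem cons_mem_prismBetween {n : ℕ} {P : Set (Fin n → ℝ)} {f g : (Fin n → ℝ) → ℝ}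
    {c : ℝ} {y : Fin n → ℝ} :
    (Fin.cons c y : Fin (n + 1) → ℝ) ∈ prismBetween P f g ↔ y ∈ P ∧ f y ≤ c ∧ c ≤ g y := by
  simp [prismBetween]

theorem cons_mem_openSegment_cons {n : ℕ} {c c₁ c₂ : ℝ} {y y₁ y₂ : Fin n → ℝ} :
    (Fin.cons c y : Fin (n + 1) → ℝ) ∈ openSegment ℝ (Fin.cons c₁ y₁) (Fin.cons c₂ y₂) ↔
      ∃ a b : ℝ, 0 < a ∧ 0 < b ∧ a + b = 1 ∧ a * c₁ + b * c₂ = c ∧ a • y₁ + b • y₂ = y := by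
  simp [openSegment, funext_iff, Fin.forall_fin_succ]

/-- Extreme points of the region between two affine graphs are the lifts, to either graph,
of extreme points of the base. -/
theorem cons_mem_extremePoints_prismBetween {n : ℕ} {P : Set (Fin n → ℝ)}
    {f g : (Fin n → ℝ) →ᵃ[ℝ] ℝ} (hfg : ∀ y ∈ P, f y < g y) {c : ℝ} {y : Fin n → ℝ} :
    (Fin.cons c y : Fin (n + 1) → ℝ) ∈ Set.extremePoints ℝ (prismBetween P f g) ↔
      y ∈ Set.extremePoints ℝ P ∧ (c = f y ∨ c = g y) := by
  simp only [mem_extremePoints_iff_left, Fin.forall_fin_succ_pi, cons_mem_prismBetween,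
    cons_mem_openSegment_cons, Fin.cons_inj]
  constructor
  · rintro ⟨⟨hy, hf, hg⟩, hext⟩
    have hc : c = f y ∨ c = g y := by
      by_contra! hne
      have h1 := lt_of_le_of_ne hf hne.1.symm
      have h2 := lt_of_le_of_ne hg hne.2
      have h3 := hfg y hy
      have h4 : g y - f y ≠ 0 := by linarith
      refine hne.1 (hext (f y) y ⟨hy, le_rfl, h3.le⟩ (g y) y ⟨hy, h3.le, le_rfl⟩
        ⟨(g y - c) / (g y - f y), (c - f y) / (g y - f y), div_pos (by linarith) (by linarith),
          div_pos (by linarith) (by linarith), by field_simp; ring, by field_simp; ring, ?_⟩).1.symm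
      rw [← add_smul]
      convert one_smul ℝ y
      field_simp
      ring
    refine ⟨⟨hy, ?_⟩, hc⟩
    rintro y₁ hy₁ y₂ hy₂ ⟨a, b, ha, hb, hab, rfl⟩
    rcases hc with rfl | rfl
    · refine (hext (f y₁) y₁ ⟨hy₁, le_rfl, (hfg _ hy₁).le⟩ (f y₂) y₂
        ⟨hy₂, le_rfl, (hfg _ hy₂).le⟩ ⟨a, b, ha, hb, hab, ?_, rfl⟩).2
      rw [Convex.combo_affine_apply hab, smul_eq_mul, smul_eq_mul]
    · refine (hext (g y₁) y₁ ⟨hy₁, (hfg _ hy₁).le, le_rfl⟩ (g y₂) y₂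
        ⟨hy₂, (hfg _ hy₂).le, le_rfl⟩ ⟨a, b, ha, hb, hab, ?_, rfl⟩).2
      rw [Convex.combo_affine_apply hab, smul_eq_mul, smul_eq_mul]
  · rintro ⟨⟨hy, hext⟩, hc⟩
    have h3 := hfg y hy
    refine ⟨⟨hy, ?_⟩, ?_⟩
    · rcases hc with rfl | rfl <;> constructor <;> linarith
    rintro c₁ y₁ ⟨hy₁, hf₁, hg₁⟩ c₂ y₂ ⟨hy₂, hf₂, hg₂⟩ ⟨a, b, ha, hb, hab, hac, hay⟩
    obtain rfl : y₁ = y := hext y₁ hy₁ y₂ hy₂ ⟨a, b, ha, hb, hab, hay⟩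
    obtain rfl : y₂ = y₁ := hext y₂ hy₂ y₁ hy₁ ⟨b, a, hb, ha, by linarith, by rw [add_comm, hay]⟩
    refine ⟨?_, rfl⟩
    obtain rfl : b = 1 - a := by linarith
    rcases hc with rfl | rfl
    · refine le_antisymm ?_ hf₁
      by_contra! h
      nlinarith
    · refine le_antisymm hg₁ ?_
      by_contra! h
      nlinarith

theorem ncard_extremePoints_prismBetween {n : ℕ} {P : Set (Fin n → ℝ)}
    {f g : (Fin n → ℝ) →ᵃ[ℝ] ℝ} (hfg : ∀ y ∈ P, f y < g y)
    (hP : (Set.extremePoints ℝ P).Finite) :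
    (Set.extremePoints ℝ (prismBetween P f g)).ncard = 2 * (Set.extremePoints ℝ P).ncard := by
  let lift (k : (Fin n → ℝ) →ᵃ[ℝ] ℝ) (y : Fin n → ℝ) : Fin (n + 1) → ℝ := Fin.cons (k y) y
  have lift_injective (k) : Function.Injective (lift k) := fun y z h => (Fin.cons_inj.1 h).2
  have hunion : Set.extremePoints ℝ (prismBetween P f g) =
      lift f '' Set.extremePoints ℝ P ∪ lift g '' Set.extremePoints ℝ P := by
    ext x
    induction x using Fin.consCases with
    | cons c y =>
      rw [cons_mem_extremePoints_prismBetween hfg]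
      simp only [lift, Set.mem_union, Set.mem_image, Fin.cons_inj]
      grind
  have hdisj : Disjoint (lift f '' Set.extremePoints ℝ P) (lift g '' Set.extremePoints ℝ P) := by
    rw [Set.disjoint_left]
    rintro _ ⟨y, hy, rfl⟩ ⟨z, -, hz⟩
    obtain ⟨h, rfl⟩ := Fin.cons_inj.1 hz
    exact (hfg z hy.1).ne' h
  rw [hunion, Set.ncard_union_eq hdisj (hP.image _) (hP.image _),
    Set.ncard_image_of_injective _ (lift_injective f),
    Set.ncard_image_of_injective _ (lift_injective g), two_mul]

theorem le_one_of_mem_kmPolytope {ε : ℝ} (hε : 0 ≤ ε) {d : ℕ} {x : Fin d → ℝ}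
    (hx : x ∈ kmPolytope ε d) (i : Fin d) : x i ≤ 1 := by
  obtain ⟨h0, h1, h2⟩ := hx
  by_cases h : i.val + 1 < d
  · linarith [(h2 i h).2, mul_nonneg hε (h0 ⟨i.val + 1, h⟩)]
  · exact h1 i (by omega)

theorem kmPolytope_one (ε : ℝ) :
    kmPolytope ε 1 = prismBetween (kmPolytope ε 0) (fun _ => 0) (fun _ => 1) := by
  ext x
  refine ⟨fun hx => ⟨⟨finZeroElim, finZeroElim, finZeroElim⟩, hx.1 0, hx.2.1 0 rfl⟩, ?_⟩
  rintro ⟨-, h0, h1⟩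
  refine ⟨fun i => ?_, fun i _ => ?_, fun i h => by omega⟩
  · rwa [Subsingleton.elim i 0]
  · rwa [Subsingleton.elim i 0]

theorem kmPolytope_succ_succ {ε : ℝ} (hε : 0 ≤ ε) (n : ℕ) :
    kmPolytope ε (n + 2) =
      prismBetween (kmPolytope ε (n + 1)) (fun y => ε * y 0) (fun y => 1 - ε * y 0) := by
  ext x
  induction x using Fin.consCases with
  | cons c y =>
    rw [cons_mem_prismBetween]
    constructor
    · rintro ⟨h0, h1, h2⟩
      refine ⟨⟨fun i => h0 i.succ, fun i hi => h1 i.succ ?_, fun i h => h2 i.succ ?_⟩, h2 0 ?_⟩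
      · simp at hi ⊢; omega
      · simp at h ⊢; omega
      · simp
    · rintro ⟨⟨h0, h1, h2⟩, h3⟩
      refine ⟨Fin.cases ((mul_nonneg hε (h0 0)).trans h3.1) h0, Fin.cases ?_ ?_,
        Fin.cases (fun _ => h3) fun i h => h2 i ?_⟩
      · intro h
        simp at h
      · intro i hi
        exact h1 i (by simp at hi ⊢; omega)
      · simp at h ⊢; omega

theorem exists_kmPolytope_succ_eq_prismBetween {ε : ℝ} (hε0 : 0 < ε) (hε1 : ε < 1 / 2) (n : ℕ) :
    ∃ f g : (Fin n → ℝ) →ᵃ[ℝ] ℝ, (∀ y ∈ kmPolytope ε n, f y < g y) ∧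
      kmPolytope ε (n + 1) = prismBetween (kmPolytope ε n) f g := by
  cases n with
  | zero =>
    exact ⟨AffineMap.const ℝ _ 0, AffineMap.const ℝ _ 1, by simp, kmPolytope_one ε⟩
  | succ n =>
    let f : (Fin (n + 1) → ℝ) →ᵃ[ℝ] ℝ := (ε • LinearMap.proj (R := ℝ) 0).toAffineMap
    refine ⟨f, AffineMap.const ℝ _ 1 - f, fun y hy => ?_, ?_⟩
    swap
    · rw [kmPolytope_succ_succ hε0.le]
      ext x
      simp [f, prismBetween]
    have := le_one_of_mem_kmPolytope hε0.le hy 0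
    change ε * y 0 < 1 - ε * y 0
    nlinarith

/-- The Klee-Minty polytope has exactly `2^d` extreme points. -/
theorem kmPolytope_card_extremePoints (d : ℕ) (hd : 1 ≤ d) (ε : ℝ)
    (hε0 : 0 < ε) (hε1 : ε < 1 / 2) :
    (Set.extremePoints ℝ (kmPolytope ε d)).ncard = 2 ^ d := by
  clear hd
  induction d with
  | zero =>
    have : kmPolytope ε 0 = {default} := by
      ext x
      simp [kmPolytope, Subsingleton.elim x default]
    simp [this]
  | succ n ih =>
    obtain ⟨f, g, hfg, h⟩ := exists_kmPolytope_succ_eq_prismBetween hε0 hε1 n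
    rw [h, ncard_extremePoints_prismBetween hfg
      (Set.finite_of_ncard_ne_zero (by rw [ih]; positivity)), ih, pow_succ']
end

section
/- Fix d ≥ 1 and a real ε with 0 < ε < 1/2. The optimizers of the objective x_1 over the Klee-Minty polytope P_ε are unique: if x ∈ P_ε and x_1 = 0, then x is the zero vector; and if x ∈ P_ε and x_1 = 1, then x = (1, 0, …, 0). -/
/-- A vanishing coordinate of a point of the Klee-Minty polytope forces every later
coordinate to vanish. -/
theorem kmPolytope_eq_zero_of_le {d : ℕ} {ε : ℝ} (hε : 0 < ε) {x : Fin d → ℝ}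
    (hx : x ∈ kmPolytope ε d) {i j : Fin d} (hij : i ≤ j) (hi : x i = 0) : x j = 0 := by
  obtain ⟨hnonneg, -, hstep⟩ := hx
  obtain ⟨j, hj⟩ := j
  replace hij : i.val ≤ j := hij
  induction j, hij using Nat.le_induction with
  | base => exact hi
  | succ k _ ih =>
    have hk : x ⟨k, by omega⟩ = 0 := ih (by omega)
    have hle := (hstep ⟨k, by omega⟩ hj).1
    rw [hk] at hle
    exact le_antisymm (nonpos_of_mul_nonpos_right hle hε) (hnonneg _)

/-- The optimizers of the objective `x₁` over the Klee-Minty polytope are unique: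
the only point with `x₁ = 0` is the zero vector, and the only point with `x₁ = 1`
is `(1,0,…,0)`. -/
theorem kmPolytope_unique_optimizers (d : ℕ) (hd : 1 ≤ d) (ε : ℝ)
    (hε0 : 0 < ε) (hε1 : ε < 1 / 2) :
    (∀ x ∈ kmPolytope ε d, x ⟨0, hd⟩ = 0 → x = fun _ => 0) ∧
    (∀ x ∈ kmPolytope ε d, x ⟨0, hd⟩ = 1 →
      x = fun i : Fin d => if i.val = 0 then (1 : ℝ) else 0) := by
  constructor
  · intro x hx h0
    funext j
    exact kmPolytope_eq_zero_of_le hε0 hx (Nat.zero_le j.val : (⟨0, hd⟩ : Fin d) ≤ j) h0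
  · intro x hx h1
    funext j
    split_ifs with hj
    · rw [← h1]
      exact congrArg x (Fin.ext hj)
    · have h : 0 + 1 < d := by omega
      have hle := (hx.2.2 ⟨0, hd⟩ h).2
      rw [h1] at hle
      have hsnd : x ⟨0 + 1, h⟩ = 0 :=
        le_antisymm (nonpos_of_mul_nonpos_right (by linarith) hε0) (hx.1 _)
      exact kmPolytope_eq_zero_of_le hε0 hx
        (show 0 + 1 ≤ j.val by omega : (⟨0 + 1, h⟩ : Fin d) ≤ j) hsnd
end
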